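/- arXiv:2603.21259 — 2 statements merged into one kernel-verified Lean document; each statement's English description precedes it below -/
import Mathlib

section
/- The only solutions (n, m, k, d) in non-negative integers to L_n = 10^d·L_m + F_k, where d = ⌊log₁₀ F_k⌋ + 1 is the number of decimal digits of F_k (k ≥ 1), are (5,1,1,1), (5,1,2,1), and (6,1,6,1); i.e., L_5 = 10·L_1 + F_1 = 10·L_1 + F_2 = 11 and L_6 = 10·L_1 + F_6 = 18. -/
def lucas : ℕ → ℕ
  | 0 => 2
  | 1 => 1
  | n + 2 => lucas (n + 1) + lucas n

namespace LucasConcat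

/-! ### Residue tables modulo `Q = 20 * 3 * 11 * 31 * 41 * 61 = 51170460`, period 120 -/

/-- the residues of `fib i`, `i < 120`, modulo `Q`, packed in base `2 ^ 26` -/
def fibTable : ℕ := 42947266501818750835164212601643247858767601399279597977195447754483070283101805349058731544468355822353419401997014802390879841130760806031258377745896295445351586513577263750200928376844458507989649708445837039402962703192737919999981803562212973363104460512105569789167786742881799526154550503286348421794973488628210962028808608615224796121927118810621816007848411715641940879740188146756109548895860000264186386109341144460533195042346153838723879141690752456857674681272836330875930934106192504954400512661454372883149972380091102496776948321547456162599069124013438024909333183651454558551707914840232559987599613824379186248154143845571326511771354790934058313563795126533466818135974287612491984622048242699962325065629841803920208502754502605223628506686868618399973608451821520895639476405949262639710090996423807779138702068207412362931780007913448963419613363255250568727569620528514415681878857745678920286284252446720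

/-- the residues of `lucas i`, `i < 120`, modulo `Q`, packed in base `2 ^ 26` -/
def lucTable : ℕ := 1246883554597464250437272977102763061289604992379656273971053020761609720989422858512938342984914258525210941313341869687226791470348166100751513228167617122918691077289926318969144349949335869523227637063986987200976160092870461761200136875730447359146213124044808623941577316002891235877408920979374627544900606377633376184453062757589403934261853045275909591924069301102879400876920888856763974516635531173669995952024036363940927237764589176732747492037431304840360834841442513416857300893743744555266887374444216311868990906080123044045156929753130840300836985989418754558273408441538847650080004943751906214417639977300316169716973302562492164342997535940287526697622717915330584086200289527723389989759866742325544708563018701326930384253850419888856012409637406495761984085512175018715550156766717670075464617761182850501142963450848633052887663139675519187620909974803482313679503138440896059846268356445835326550473753723905507330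

def ft (i : ℕ) : ℕ := (fibTable >>> (26 * i)) % 67108864
def lt (i : ℕ) : ℕ := (lucTable >>> (26 * i)) % 67108864

def allBelow (f : ℕ → Bool) : ℕ → Bool
  | 0 => true
  | n + 1 => f n && allBelow f n

theorem allBelow_spec (f : ℕ → Bool) (N : ℕ) (h : allBelow f N = true) (i : ℕ) (hi : i < N) :
    f i = true := by
  induction N with
  | zero => omega
  | succ n ih =>
    simp only [allBelow, Bool.and_eq_true] at h
    rcases Nat.lt_succ_iff_lt_or_eq.mp hi with h1 | h1
    · exact ih h.2 h1
    · rw [h1]; exact h.1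

theorem ft_rec : allBelow (fun i => Nat.beq (ft ((i + 2) % 120))
    ((ft ((i + 1) % 120) + ft (i % 120)) % 51170460)) 120 = true := by decide +kernel

theorem lt_rec : allBelow (fun i => Nat.beq (lt ((i + 2) % 120))
    ((lt ((i + 1) % 120) + lt (i % 120)) % 51170460)) 120 = true := by decide +kernel

theorem fib_mod (n : ℕ) : Nat.fib n % 51170460 = ft (n % 120) := by
  induction n using Nat.twoStepInduction with
  | zero => decide +kernel
  | one => decide +kernel
  | more n h0 h1 =>
    have := Nat.eq_of_beq_eq_true (allBelow_spec _ _ ft_rec (n % 120) (Nat.mod_lt _ (by norm_num)))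
    have e1 : (n % 120 + 2) % 120 = (n + 2) % 120 := by omega
    have e2 : (n % 120 + 1) % 120 = (n + 1) % 120 := by omega
    have e3 : n % 120 % 120 = n % 120 := by omega
    rw [e1, e2, e3, ← h0, ← h1] at this
    rw [this, Nat.fib_add_two]
    omega

theorem lucas_mod (n : ℕ) : lucas n % 51170460 = lt (n % 120) := by
  induction n using Nat.twoStepInduction with
  | zero => decide +kernel
  | one => decide +kernel
  | more n h0 h1 =>
    have := Nat.eq_of_beq_eq_true (allBelow_spec _ _ lt_rec (n % 120) (Nat.mod_lt _ (by norm_num)))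
    have e1 : (n % 120 + 2) % 120 = (n + 2) % 120 := by omega
    have e2 : (n % 120 + 1) % 120 = (n + 1) % 120 := by omega
    have e3 : n % 120 % 120 = n % 120 := by omega
    rw [e1, e2, e3, ← h0, ← h1] at this
    rw [this, lucas]
    omega

/-- innermost test: `d = e + 2 f` -/
def chkD (a b x e f : ℕ) : Bool :=
  !(Nat.beq (a % 2558523) ((10 ^ (e + 2 * f) * x + b) % 2558523))

def chkE (a b x e : ℕ) : Bool :=
  !(Nat.beq (a % 11) ((10 ^ e * x + b) % 11)) || allBelow (chkD a b x e) 30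

def chkM (a b x : ℕ) : Bool :=
  !(Nat.beq (a % 3) ((x + b) % 3)) || allBelow (chkE a b x) 2

def chkK (n k : ℕ) : Bool :=
  !(Nat.beq (lt n % 20) (ft k % 20)) ||
    allBelow (fun c => chkM (lt n) (ft k) (lt ((n + 242 - k - c) % 120))) 8

theorem sieve : allBelow (fun n => allBelow (fun k => chkK n k) 120) 120 = true := by
  decide +kernel

theorem pow_mod_P (d : ℕ) : 10 ^ d % 2558523 = 10 ^ (d % 60) % 2558523 := by
  conv_lhs => rw [← Nat.div_add_mod d 60, pow_add, pow_mul, Nat.mul_mod, Nat.pow_mod]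
  norm_num

theorem no_large (n m k d c : ℕ) (hd : 2 ≤ d) (hc : c < 8) (hn : n + 2 = m + k + c)
    (h : lucas n = 10 ^ d * lucas m + Nat.fib k) : False := by
  have hK : chkK (n % 120) (k % 120) = true :=
    allBelow_spec _ _ (allBelow_spec _ _ sieve (n % 120) (Nat.mod_lt _ (by norm_num)))
      (k % 120) (Nat.mod_lt _ (by norm_num))
  have hm : (n % 120 + 242 - k % 120 - c) % 120 = m % 120 := by omega
  unfold chkK at hK
  rw [Bool.or_eq_true] at hK
  obtain ⟨t, rfl⟩ : ∃ t, d = t + 2 := ⟨d - 2, by omega⟩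
  have hA := lucas_mod n
  have hB := fib_mod k
  have hX := lucas_mod m
  rcases hK with hK | hK
  · have h20 : lt (n % 120) % 20 = ft (k % 120) % 20 := by
      rw [← hA, ← hB, h, pow_add]
      have : 10 ^ t * 10 ^ 2 * lucas m = 20 * (5 * 10 ^ t * lucas m) := by ring
      rw [this]; omega
    simp [h20] at hK
  · have hM := allBelow_spec _ _ hK c hc
    simp only [hm] at hM
    set d := t + 2 with hdef
    have key : ∀ q e, q ∣ 51170460 → 10 ^ d % q = 10 ^ e % q →
        lt (n % 120) % q = (10 ^ e * lt (m % 120) + ft (k % 120)) % q := by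
      intro q e hq he
      rw [← hA, ← hB, ← hX, Nat.mod_mod_of_dvd _ hq, h]
      have h1 : lucas m % 51170460 ≡ lucas m [MOD q] := Nat.mod_mod_of_dvd _ hq
      have h2 : Nat.fib k % 51170460 ≡ Nat.fib k [MOD q] := Nat.mod_mod_of_dvd _ hq
      have h3 : 10 ^ d ≡ 10 ^ e [MOD q] := he
      exact (h3.mul h1.symm).add h2.symm
    have p3 : 10 ^ d % 3 = 10 ^ 0 % 3 := by rw [Nat.pow_mod]; norm_num
    have p11 : 10 ^ d % 11 = 10 ^ (d % 2) % 11 := by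
      conv_lhs => rw [← Nat.div_add_mod d 2, pow_add, pow_mul, Nat.mul_mod, Nat.pow_mod]
      norm_num
    have k3 := key 3 0 (by norm_num) p3
    have k11 := key 11 (d % 2) (by norm_num) p11
    have kP := key 2558523 (d % 60) (by norm_num) (pow_mod_P d)
    unfold chkM at hM
    rw [Bool.or_eq_true] at hM
    rcases hM with hM | hM
    · rw [pow_zero, one_mul] at k3
      simp [k3] at hM
    · have hE := allBelow_spec _ _ hM (d % 2) (Nat.mod_lt _ (by norm_num))
      unfold chkE at hE
      rw [Bool.or_eq_true] at hE
      rcases hE with hE | hE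
      · simp [k11] at hE
      · have hD := allBelow_spec _ _ hE (d % 60 / 2) (by omega)
        have e : d % 2 + 2 * (d % 60 / 2) = d % 60 := by omega
        unfold chkD at hD
        rw [e] at hD
        simp [kP] at hD

/-! ### Size estimates -/

theorem lucas_pos (n : ℕ) : 1 ≤ lucas n := by
  induction n using Nat.twoStepInduction with
  | zero => decide
  | one => decide
  | more n h0 h1 => rw [lucas]; omega

theorem lucas_le_succ (n : ℕ) : lucas (n + 1) ≤ lucas (n + 2) := by
  rw [lucas]; omega

theorem lucas_mono {a b : ℕ} (ha : 1 ≤ a) (hab : a ≤ b) : lucas a ≤ lucas b := by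
  induction b, hab using Nat.le_induction with
  | base => exact le_rfl
  | succ b hb ih =>
    obtain ⟨t, rfl⟩ : ∃ t, b = t + 1 := ⟨b - 1, by omega⟩
    exact ih.trans (lucas_le_succ t)

theorem lucas_add (m k : ℕ) :
    lucas (m + k + 1) = Nat.fib (k + 1) * lucas (m + 1) + Nat.fib k * lucas m := by
  induction k using Nat.twoStepInduction with
  | zero => simp
  | one =>
    have : lucas (m + 1 + 1) = lucas (m + 1) + lucas m := by rw [lucas]
    simp [this]
  | more k h0 h1 =>
    have e : lucas (m + (k + 2) + 1) = lucas (m + (k + 1) + 1) + lucas (m + k + 1) := by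
      show lucas (m + k + 1 + 2) = _
      rw [lucas]; rfl
    rw [e, h0, h1, Nat.fib_add_two (n := k + 1), Nat.fib_add_two (n := k)]
    ring

theorem lucas_ratio (m : ℕ) : lucas (m + 1) ≤ 3 * lucas m ∧ lucas m ≤ 2 * lucas (m + 1) := by
  induction m with
  | zero => decide
  | succ m ih =>
    have : lucas (m + 1 + 1) = lucas (m + 1) + lucas m := by rw [lucas]
    omega

theorem lucas_add_le (m k : ℕ) : lucas (m + k) ≤ Nat.fib (k + 3) * lucas m := by
  induction k using Nat.twoStepInduction with
  | zero =>
    have : Nat.fib 3 = 2 := by decide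
    simp only [Nat.zero_add, Nat.add_zero, this]; omega
  | one =>
    have : Nat.fib 4 = 3 := by decide
    simpa [this] using (lucas_ratio m).1
  | more k h0 h1 =>
    have e : lucas (m + (k + 2)) = lucas (m + (k + 1)) + lucas (m + k) := by
      show lucas (m + k + 2) = _
      rw [lucas]; rfl
    rw [e, Nat.fib_add_two (n := k + 3), add_mul]
    have h1' : lucas (m + (k + 1)) ≤ Nat.fib (k + 3 + 1) * lucas m := h1
    omega

theorem lucas_seven (m : ℕ) : 10 * lucas m + 2 ≤ lucas (m + 7) := by
  have h := lucas_add m 6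
  have f6 : Nat.fib 6 = 8 := by decide
  have f7 : Nat.fib 7 = 13 := by decide
  rw [f6, f7] at h
  have h2 := (lucas_ratio m).2
  have h3 := lucas_pos m
  have h4 := lucas_pos (m + 1)
  have h5 : lucas (m + 7) = 13 * lucas (m + 1) + 8 * lucas m := h
  omega

theorem upper (n m k d : ℕ) (hk : 1 ≤ k) (hd : 10 ^ d ≤ 10 * Nat.fib k)
    (h : lucas n = 10 ^ d * lucas m + Nat.fib k) : n < m + k + 6 := by
  by_contra hcon
  obtain ⟨t, rfl⟩ : ∃ t, k = t + 1 := ⟨k - 1, by omega⟩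
  have h1 : lucas (m + 6 + t + 1) ≤ lucas n := lucas_mono (by omega) (by omega)
  rw [lucas_add] at h1
  have h2 : Nat.fib (t + 1) * (10 * lucas m + 2) ≤ Nat.fib (t + 1) * lucas (m + 6 + 1) :=
    Nat.mul_le_mul_left _ (lucas_seven m)
  have h3 : 10 ^ d * lucas m ≤ 10 * Nat.fib (t + 1) * lucas m := Nat.mul_le_mul_right _ hd
  have h4 : 0 < Nat.fib (t + 1) := Nat.fib_pos.mpr (by omega)
  nlinarith

theorem lower (n m k d : ℕ) (hk : 3 ≤ k) (hd : Nat.fib k < 10 ^ d) (hd1 : 1 ≤ d)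
    (h : lucas n = 10 ^ d * lucas m + Nat.fib k) : m + k < n + 3 := by
  by_contra hcon
  obtain ⟨t, rfl⟩ : ∃ t, k = t + 3 := ⟨k - 3, by omega⟩
  have hp := lucas_pos m
  have h10 : 10 ^ 1 ≤ 10 ^ d := Nat.pow_le_pow_right (by norm_num) hd1
  have hmul : Nat.fib (t + 3) * lucas m < 10 ^ d * lucas m := Nat.mul_lt_mul_of_pos_right hd hp
  have hn : n ≠ 0 := by
    rintro rfl
    have : lucas 0 = 2 := by decide
    have : 10 ^ d * 1 ≤ 10 ^ d * lucas m := Nat.mul_le_mul_left _ hp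
    omega
  have h1 : lucas n ≤ lucas (m + t) := lucas_mono (by omega) (by omega)
  have h2 := lucas_add_le m t
  omega

set_option synthInstance.maxSize 2000 in
set_option synthInstance.maxHeartbeats 200000 in
theorem small (n m k : ℕ) (hk : 1 ≤ k) (hf : Nat.fib k < 10)
    (h : lucas n = 10 * lucas m + Nat.fib k) :
    (n = 5 ∧ m = 1 ∧ k = 1) ∨ (n = 5 ∧ m = 1 ∧ k = 2) ∨ (n = 6 ∧ m = 1 ∧ k = 6) := by
  have hk6 : k ≤ 6 := by
    by_contra hcon
    have h7 : Nat.fib 7 ≤ Nat.fib k := Nat.fib_mono (by omega)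
    have : Nat.fib 7 = 13 := by decide
    omega
  have hm : m < 7 := by
    by_contra hcon
    obtain ⟨t, rfl⟩ : ∃ t, m = t + 2 := ⟨m - 2, by omega⟩
    have h6 : lucas 6 ≤ lucas (t + 1) := lucas_mono (by omega) (by omega)
    have v6 : lucas 6 = 18 := by decide
    have r1 := (lucas_ratio t).2
    have r0 := lucas_le_succ t
    have a2 : lucas (t + 2) = lucas (t + 1) + lucas t := by rw [lucas]
    have a3 : lucas (t + 3) = lucas (t + 2) + lucas (t + 1) := by rw [lucas]
    have a4 : lucas (t + 4) = lucas (t + 3) + lucas (t + 2) := by rw [lucas]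
    have a5 : lucas (t + 5) = lucas (t + 4) + lucas (t + 3) := by rw [lucas]
    have a6 : lucas (t + 6) = lucas (t + 5) + lucas (t + 4) := by rw [lucas]
    have a7 : lucas (t + 7) = lucas (t + 6) + lucas (t + 5) := by rw [lucas]
    obtain ⟨s, rfl⟩ : ∃ s, t = s + 1 := ⟨t - 1, by omega⟩
    have r2 := (lucas_ratio s)
    have b2 : lucas (s + 1 + 1) = lucas (s + 1) + lucas s := by rw [lucas]
    have r3 : lucas (s + 1) ≤ 2 * lucas s := by
      obtain ⟨u, rfl⟩ : ∃ u, s = u + 2 := ⟨s - 2, by omega⟩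
      have c2 : lucas (u + 2 + 1) = lucas (u + 1 + 1) + lucas (u + 1) := by rw [lucas]
      have c3 := lucas_le_succ u
      have c4 : lucas (u + 1 + 1) = lucas (u + 2) := rfl
      omega
    have r4 : lucas s ≤ lucas (s + 1) := by
      obtain ⟨u, rfl⟩ : ∃ u, s = u + 1 := ⟨s - 1, by omega⟩
      exact lucas_le_succ u
    rcases Nat.lt_or_ge n (s + 1 + 7) with hn | hn
    · have hn0 : n ≠ 0 := by
        rintro rfl
        have : lucas 0 = 2 := by decide
        omega
      have : lucas n ≤ lucas (s + 1 + 6) := lucas_mono (by omega) (by omega)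
      omega
    · have : lucas (s + 1 + 7) ≤ lucas n := lucas_mono (by omega) hn
      omega
  have hn := upper n m k 1 hk (by have := Nat.fib_pos.mpr hk; omega) (by simpa using h)
  have hn' : n < 20 := by omega
  clear hn hf
  have H : ∀ m < 7, ∀ k < 7, ∀ n < 20, ¬ (1 ≤ k ∧ lucas n = 10 * lucas m + Nat.fib k) ∨
      ((n = 5 ∧ m = 1 ∧ k = 1) ∨ (n = 5 ∧ m = 1 ∧ k = 2) ∨ (n = 6 ∧ m = 1 ∧ k = 6)) := by
    decide +kernel
  exact (H m hm k (by omega) n hn').resolve_left (fun hh => hh ⟨hk, h⟩)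

end LucasConcat

open LucasConcat in
theorem lucas_concat_lucas_fib_base10 (n m k d : ℕ) (hk : 1 ≤ k)
    (hd : d = Nat.log 10 (Nat.fib k) + 1) :
    lucas n = 10 ^ d * lucas m + Nat.fib k ↔
      (n, m, k, d) ∈ ({(5, 1, 1, 1), (5, 1, 2, 1), (6, 1, 6, 1)} :
        Set (ℕ × ℕ × ℕ × ℕ)) := by
  have hfp : Nat.fib k ≠ 0 := (Nat.fib_pos.mpr hk).ne'
  have hlt : Nat.fib k < 10 ^ d := by
    rw [hd]; exact Nat.lt_pow_succ_log_self (by norm_num) _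
  have hle : 10 ^ d ≤ 10 * Nat.fib k := by
    rw [hd, pow_succ, mul_comm]
    exact Nat.mul_le_mul_left _ (Nat.pow_log_le_self 10 hfp)
  have hd1 : 1 ≤ d := by omega
  clear hd
  simp only [Set.mem_insert_iff, Set.mem_singleton_iff, Prod.mk.injEq]
  constructor
  · intro h
    rcases Nat.lt_or_ge d 2 with hd2 | hd2
    · obtain rfl : d = 1 := by omega
      rw [pow_one] at h hlt
      have := small n m k hk hlt h
      tauto
    · exfalso
      have h100 : 10 ^ 2 ≤ 10 ^ d := Nat.pow_le_pow_right (by norm_num) hd2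
      have hk3 : 3 ≤ k := by
        by_contra hcon
        have h3 : Nat.fib k ≤ Nat.fib 3 := Nat.fib_mono (by omega)
        have : Nat.fib 3 = 2 := by decide
        omega
      have hu := upper n m k d hk hle h
      have hl := lower n m k d hk3 hlt hd1 h
      exact no_large n m k d (n + 2 - m - k) hd2 (by omega) (by omega) h
  · rintro (⟨rfl, rfl, rfl, rfl⟩ | ⟨rfl, rfl, rfl, rfl⟩ | ⟨rfl, rfl, rfl, rfl⟩) <;> decide
end

section
/- The only solutions (n, m, k, d) in non-negative integers to L_n = 2^d·L_m + F_k with k ≥ 1 and d = ⌊log₂ F_k⌋ + 1 the number of binary digits of F_k are: (0,1,0,1) is excluded since k≥1; the full list is (2,1,1,1), (2,1,2,1), (3,0,0,1) excluded, (4,1,4,2), (4,2,1,1), (4,2,2,1), (5,0,4,2), (6,3,3,2), (7,1,7,4), (7,2,5,3), (8,5,4,2). State precisely: for k ≥ 1, the solution set is {(2,1,1,1),(2,1,2,1),(4,1,4,2),(4,2,1,1),(4,2,2,1),(5,0,4,2),(6,3,3,2),(7,1,7,4),(7,2,5,3),(8,5,4,2)}. -/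
theorem luc_rec (n : ℕ) : lucas (n + 2) = lucas (n + 1) + lucas n := rfl

theorem luc_fib (n : ℕ) : lucas (n + 1) = Nat.fib n + Nat.fib (n + 2) := by
  induction n using Nat.twoStepInduction with
  | zero => decide
  | one => decide
  | more n h1 h2 =>
    have e1 : Nat.fib (n + 2) = Nat.fib n + Nat.fib (n + 1) := Nat.fib_add_two
    have e2 : Nat.fib (n + 1 + 2) = Nat.fib (n + 1) + Nat.fib (n + 1 + 1) := Nat.fib_add_two
    have e3 : Nat.fib (n + 2 + 2) = Nat.fib (n + 2) + Nat.fib (n + 2 + 1) := Nat.fib_add_two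
    have e4 := luc_rec (n + 1)
    simp only [Nat.add_assoc, Nat.reduceAdd] at *
    omega

theorem luc_pos (n : ℕ) : 0 < lucas n := by
  induction n using Nat.twoStepInduction with
  | zero => decide
  | one => decide
  | more n h1 h2 => rw [luc_rec]; omega

theorem luc_lt {a b : ℕ} (ha : 1 ≤ a) (h : a < b) : lucas a < lucas b := by
  induction b, h using Nat.le_induction with
  | base =>
    obtain ⟨c, rfl⟩ : ∃ c, a = c + 1 := ⟨a - 1, by omega⟩
    have := luc_rec c
    have := luc_pos c
    simp only [Nat.succ_eq_add_one, Nat.add_assoc, Nat.reduceAdd] at *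
    omega
  | succ b hb ih =>
    obtain ⟨c, rfl⟩ : ∃ c, b = c + 1 := ⟨b - 1, by omega⟩
    have := luc_rec c
    have := luc_pos c
    simp only [Nat.succ_eq_add_one, Nat.add_assoc, Nat.reduceAdd] at *
    omega

theorem luc_le {a b : ℕ} (ha : 1 ≤ a) (h : a ≤ b) : lucas a ≤ lucas b := by
  rcases h.eq_or_lt with rfl | h
  · exact le_rfl
  · exact (luc_lt ha h).le

theorem luc_loc {a n : ℕ} (ha : 2 ≤ a) (h1 : lucas a < lucas n)
    (h2 : lucas n < lucas (a + 2)) : n = a + 1 := by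
  by_contra hne
  rcases Nat.lt_or_ge a n with h | h
  · have := luc_le (a := a + 2) (b := n) (by omega) (by omega)
    omega
  · rcases Nat.eq_zero_or_pos n with rfl | hn
    · have h3 := luc_le (a := 2) (b := a) (by omega) ha
      have e2 : lucas 2 = 3 := by decide
      have e0 : lucas 0 = 2 := by decide
      omega
    · have := luc_le hn h
      omega

theorem luc_add (m k : ℕ) :
    lucas (m + 1 + k) = Nat.fib (k + 1) * lucas (m + 1) + Nat.fib k * lucas m := by
  induction k using Nat.twoStepInduction with
  | zero => simp
  | one => simp [luc_rec]
  | more k h1 h2 =>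
    have e := luc_rec (m + 1 + k)
    have e1 : Nat.fib (k + 2) = Nat.fib k + Nat.fib (k + 1) := Nat.fib_add_two
    have e2 : Nat.fib (k + 2 + 1) = Nat.fib (k + 1) + Nat.fib (k + 1 + 1) := Nat.fib_add_two
    have e3 : Nat.fib (k + 1 + 1) = Nat.fib (k + 2) := rfl
    rw [e3, e1] at h2
    rw [e2, e3, e1, ← Nat.add_assoc, e, Nat.add_assoc _ k 1, h1, h2]
    ring

theorem rec_shift (H : ℕ → ℤ) (hH : ∀ i, H (i + 2) = H (i + 1) + H i) (s : ℕ) :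
    ∀ k, H (k + 2 * s) = lucas s * H (k + s) - (-1) ^ s * H k := by
  induction s using Nat.twoStepInduction with
  | zero => intro k; simp [lucas]; ring
  | one => intro k; simp [lucas, hH]
  | more s h1 h2 =>
    intro k
    have a1 := h1 (k + 2)
    have a2 := h2 (k + 1)
    have e1 : k + 2 * (s + 2) = (k + 2 + 2 * s) + 2 := by ring
    have e2 : k + 1 + 2 * (s + 1) = (k + 2 + 2 * s) + 1 := by ring
    have e3 : k + 1 + (s + 1) = k + (s + 2) := by ring
    have e4 : k + 2 + s = k + (s + 2) := by ring
    rw [e2, e3] at a2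
    rw [e4] at a1
    rw [e1, hH, a1, a2, hH k, luc_rec]
    push_cast
    ring

theorem fib_shift (u : ℕ) : ∀ a : ℕ,
    (Nat.fib (a + 2 * u) : ℤ) = Nat.fib u * lucas (a + u) + (-1) ^ u * Nat.fib a := by
  induction u using Nat.twoStepInduction with
  | zero => intro a; simp
  | one =>
    intro a
    have e1 : Nat.fib (a + 2) = Nat.fib a + Nat.fib (a + 1) := Nat.fib_add_two
    simp [luc_fib]
  | more u h1 h2 =>
    intro a
    have a1 := h1 (a + 2)
    have a2 := h2 (a + 1)
    have e1 : a + 2 * (u + 2) = (a + 2 + 2 * u) + 2 := by ring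
    have e2 : a + 1 + 2 * (u + 1) = (a + 2 + 2 * u) + 1 := by ring
    have e3 : a + 1 + (u + 1) = a + (u + 2) := by ring
    have e4 : a + 2 + u = a + (u + 2) := by ring
    rw [e2, e3] at a2
    rw [e4] at a1
    rw [e1, Nat.fib_add_two, Nat.fib_add_two (n := u)]
    push_cast
    rw [a1, a2, Nat.fib_add_two (n := a)]
    push_cast
    ring

theorem luc_ne_fib {i j : ℕ} (h : lucas j = Nat.fib i) : j ≤ 2 ∧ i ≤ 4 := by
  have hj : j ≤ 2 := by
    by_contra hj
    obtain ⟨c, rfl⟩ : ∃ c, j = c + 2 + 1 := ⟨j - 3, by omega⟩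
    have e := luc_fib (c + 2)
    have e1 : Nat.fib (c + 2 + 2 + 1) = _ := Nat.fib_add_two (n := c + 2 + 1)
    have e2 : Nat.fib (c + 2 + 1) = _ := Nat.fib_add_two (n := c + 1)
    have p1 : 0 < Nat.fib (c + 2) := Nat.fib_pos.2 (by omega)
    have p2 : 0 < Nat.fib (c + 1) := Nat.fib_pos.2 (by omega)
    have e5 : Nat.fib (c + 1 + 1) = Nat.fib (c + 2) := rfl
    have e6 : Nat.fib (c + 2 + 1 + 1) = Nat.fib (c + 2 + 2) := rfl
    rcases Nat.lt_or_ge (c + 2 + 2) i with hi | hi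
    · have := Nat.fib_mono (show c + 2 + 2 + 1 ≤ i by omega)
      omega
    · have := Nat.fib_mono hi
      omega
  refine ⟨hj, ?_⟩
  by_contra hi
  have := Nat.fib_mono (show 5 ≤ i by omega)
  have e : Nat.fib 5 = 5 := by decide
  have : lucas j ≤ 3 := by interval_cases j <;> decide
  omega

theorem no_dvd {L x y : ℕ} {e1 e2 : ℤ} (h1 : e1 = 1 ∨ e1 = -1) (h2 : e2 = 1 ∨ e2 = -1)
    (hlt : x + y < L) (hne : x ≠ y) (h : (L : ℤ) ∣ e1 * x + e2 * y) : False := by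
  have : e1 * x + e2 * y = 0 := by
    apply Int.eq_zero_of_abs_lt_dvd h
    rw [abs_lt]
    rcases h1 with rfl | rfl <;> rcases h2 with rfl | rfl <;> constructor <;> omega
  rcases h1 with rfl | rfl <;> rcases h2 with rfl | rfl <;> omega

/-- No solution modulo `L_m` for `m = M + 1 ≥ 6`. -/
theorem mod_lemma {M : ℕ} (hM : 5 ≤ M) (k : ℕ)
    (h : (lucas (M + 1) : ℤ) ∣ (lucas (M + k) : ℤ) - Nat.fib k) : False := by
  induction k using Nat.strong_induction_on with
  | _ k ih =>
  rcases Nat.lt_or_ge k (2 * (M + 1)) with hk | hk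
  swap
  · obtain ⟨c, rfl⟩ : ∃ c, k = c + 2 * (M + 1) := ⟨k - 2 * (M + 1), by omega⟩
    apply ih c (by omega)
    have := rec_shift (fun i => (lucas (M + i) : ℤ) - Nat.fib i) (by
      intro i
      simp only [← Nat.add_assoc, luc_rec, Nat.fib_add_two]
      push_cast
      ring) (M + 1) c
    rw [this] at h
    have h2 := (Int.dvd_iff_dvd_of_dvd_sub (by simp :
      (lucas (M + 1) : ℤ) ∣ (lucas (M + 1) : ℤ) * ((lucas (M + (c + (M + 1))) : ℤ)
        - Nat.fib (c + (M + 1))) - 0)).2 (dvd_zero _)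
    have h3 := (dvd_sub_right h2).1 h
    rcases neg_one_pow_eq_or ℤ (M + 1) with e | e <;> rw [e] at h3
    · simpa using h3
    · simpa [dvd_sub_comm] using h3
  have hsgn : ∀ s : ℕ, -(-1 : ℤ) ^ s = 1 ∨ -(-1 : ℤ) ^ s = -1 := by
    intro s
    rcases neg_one_pow_eq_or ℤ s with e | e <;> rw [e] <;> simp
  rcases Nat.lt_or_ge M 7 with h7 | h7
  · clear ih
    interval_cases M <;> interval_cases k <;> revert h <;> decide
  have m1 := luc_lt (a := M) (b := M + 1) (by omega) (by omega)
  have m2 := luc_lt (a := 2) (b := M) (by omega) (by omega)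
  have c2 : lucas 2 = 3 := by decide
  have hlf := luc_fib M
  have hlf2 := luc_fib (M - 2)
  have hM2 : M - 2 + 1 = M - 1 := by omega
  have hM3 : M - 2 + 2 = M := by omega
  rw [hM2, hM3] at hlf2
  have f1 := Nat.fib_lt_fib_succ (n := M - 2) (by omega)
  have f2 := Nat.fib_lt_fib_succ (n := M - 1) (by omega)
  have f3 := Nat.fib_lt_fib_succ (n := M) (by omega)
  have hM4 : M - 1 + 1 = M := by omega
  rw [hM2] at f1
  rw [hM4] at f2
  have fr : Nat.fib (M + 2) = Nat.fib M + Nat.fib (M + 1) := Nat.fib_add_two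
  rcases Nat.lt_or_ge k 2 with hk2 | hk2
  · interval_cases k
    · refine no_dvd (x := lucas M) (y := 0) (Or.inl rfl) (Or.inl rfl) ?_ ?_ (by simpa using h) <;>
        omega
    · rw [Nat.fib_one] at h
      have := (dvd_sub_right (dvd_refl _)).1 h
      refine no_dvd (x := 1) (y := 0) (Or.inl rfl) (Or.inl rfl) ?_ ?_ (by simpa using this) <;>
        omega
  rcases Nat.lt_or_ge (M + 1) k with hk3 | hk3
  · -- k = m + u
    obtain ⟨u, rfl⟩ : ∃ u, k = M + 1 + (u + 1) := ⟨k - (M + 2), by omega⟩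
    obtain ⟨a, rfl⟩ : ∃ a, M = a + u := ⟨M - u, by omega⟩
    have a1 := rec_shift (fun i => (lucas i : ℤ)) (by
      intro i; simp only [luc_rec]; push_cast; ring) (a + u + 1) u
    have a2 := fib_shift (u + 1) a
    rw [show a + u + (a + u + 1 + (u + 1)) = u + 2 * (a + u + 1) by ring, a1,
      show a + u + 1 + (u + 1) = a + 2 * (u + 1) by ring, a2,
      show a + (u + 1) = a + u + 1 by ring] at h
    have h3 : (lucas (a + u + 1) : ℤ) ∣ -(-1) ^ (a + u + 1) * (lucas u : ℤ)
        + -(-1) ^ (u + 1) * (Nat.fib a : ℤ) := by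
      obtain ⟨q, hq⟩ := h
      exact ⟨q - ((lucas (u + (a + u + 1)) : ℤ) - Nat.fib (u + 1)), by linear_combination hq⟩
    refine no_dvd (hsgn _) (hsgn _) ?_ ?_ h3
    · have b1 : lucas u ≤ lucas (a + u - 1) := by
        rcases Nat.eq_zero_or_pos u with rfl | hu
        · have := luc_le (a := 2) (b := a + 0 - 1) (by omega) (by omega)
          have c0 : lucas 0 = 2 := by decide
          omega
        · exact luc_le hu (by omega)
      have b2 := Nat.fib_mono (show a ≤ a + u by omega)
      omega
    · intro heq
      have := luc_ne_fib heq
      omega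
  · obtain ⟨s, rfl⟩ : ∃ s, k = s + 1 := ⟨k - 1, by omega⟩
    obtain ⟨a, ha⟩ : ∃ a, M + 1 = a + s := ⟨M + 1 - s, by omega⟩
    have a1 := rec_shift (fun i => (lucas i : ℤ)) (by
      intro i; simp only [luc_rec]; push_cast; ring) s a
    rw [show M + (s + 1) = a + 2 * s by omega, a1, ha] at h
    have h3 : (lucas (a + s) : ℤ) ∣ -(-1) ^ s * (lucas a : ℤ)
        + (-1) * (Nat.fib (s + 1) : ℤ) := by
      obtain ⟨q, hq⟩ := h
      exact ⟨q - (lucas s : ℤ), by linear_combination hq⟩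
    refine no_dvd (hsgn _) (Or.inr rfl) ?_ ?_ h3
    · rw [← ha]
      rcases Nat.lt_or_ge 1 s with hs | hs
      · have b1 : lucas a ≤ lucas (M - 1) := luc_le (by omega) (by omega)
        have b2 := Nat.fib_mono (show s + 1 ≤ M + 1 by omega)
        omega
      · obtain rfl : s = 1 := by omega
        obtain rfl : a = M := by omega
        have e1 : Nat.fib (1 + 1) = 1 := by decide
        have m3 := luc_lt (a := 2) (b := a - 1) (by omega) (by omega)
        have := luc_rec (a - 1)
        rw [show a - 1 + 2 = a + 1 by omega, show a - 1 + 1 = a by omega] at this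
        omega
    · intro heq
      have := luc_ne_fib heq
      omega

theorem fib_pow_two {j e : ℕ} (h : Nat.fib j = 2 ^ e) : j ≤ 6 := by
  rcases Nat.lt_or_ge e 4 with he | he
  · by_contra hj
    have := Nat.fib_mono (show 7 ≤ j by omega)
    have c : Nat.fib 7 = 13 := by decide
    have : 2 ^ e ≤ 2 ^ 3 := Nat.pow_le_pow_right (by omega) (by omega)
    omega
  · exfalso
    have h16 : 16 ∣ Nat.fib j := by
      rw [h]; exact pow_dvd_pow 2 he
    have hg := Nat.fib_gcd j 12
    have h1 : 16 ∣ Nat.fib (Nat.gcd j 12) := by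
      rw [hg]; exact Nat.dvd_gcd h16 (by decide)
    have h2 : Nat.gcd j 12 ∣ 12 := Nat.gcd_dvd_right _ _
    have h3 : Nat.gcd j 12 = 12 := by
      have : Nat.gcd j 12 ≤ 12 := Nat.le_of_dvd (by omega) h2
      generalize Nat.gcd j 12 = g at *
      interval_cases g <;> revert h1 h2 <;> decide
    have h4 : 12 ∣ j := h3 ▸ Nat.gcd_dvd_left j 12
    have h5 : 3 ∣ Nat.fib j := dvd_trans (by decide : 3 ∣ Nat.fib 12) (Nat.fib_dvd _ _ h4)
    rw [h] at h5
    have := Nat.Prime.dvd_of_dvd_pow Nat.prime_three h5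
    omega

theorem fib_seven {j d : ℕ} (h : 2 * Nat.fib j = 7 * 2 ^ d) : False := by
  have h7 : 7 ∣ Nat.fib j := by
    have : 7 ∣ 2 * Nat.fib j := ⟨_, h⟩
    omega
  have hg := Nat.fib_gcd j 8
  have h1 : 7 ∣ Nat.fib (Nat.gcd j 8) := by
    rw [hg]; exact Nat.dvd_gcd h7 (by decide)
  have h2 : Nat.gcd j 8 ∣ 8 := Nat.gcd_dvd_right _ _
  have h3 : Nat.gcd j 8 = 8 := by
    have : Nat.gcd j 8 ≤ 8 := Nat.le_of_dvd (by omega) h2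
    generalize Nat.gcd j 8 = g at *
    interval_cases g <;> revert h1 h2 <;> decide
  have h4 : 8 ∣ j := h3 ▸ Nat.gcd_dvd_left j 8
  have h5 : 3 ∣ Nat.fib j := dvd_trans (by decide : 3 ∣ Nat.fib 8) (Nat.fib_dvd _ _ h4)
  have h6 : 3 ∣ 2 ^ d := by omega
  have := Nat.Prime.dvd_of_dvd_pow Nat.prime_three h6
  omega

theorem cassini8 (k : ℕ) : let a : ZMod 8 := Nat.fib k; let b : ZMod 8 := Nat.fib (k + 1)
    b ^ 2 - a * b - a ^ 2 = 1 ∨ b ^ 2 - a * b - a ^ 2 = -1 := by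
  induction k with
  | zero => left; simp
  | succ k ih =>
    simp only at ih ⊢
    rw [Nat.fib_add_two]
    push_cast
    rcases ih with ih | ih
    · right; linear_combination -ih
    · left; linear_combination -ih

theorem no_eight {k : ℕ} (h : 8 ∣ 3 * Nat.fib k + 7 * Nat.fib (k + 1)) : False := by
  have h1 := (ZMod.natCast_eq_zero_iff _ 8).2 h
  have h2 := cassini8 k
  push_cast at h1
  simp only at h2
  generalize (Nat.fib k : ZMod 8) = a at *
  generalize (Nat.fib (k + 1) : ZMod 8) = b at *
  revert a b
  decide

set_option maxHeartbeats 1000000 in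
theorem lucas_concat_lucas_fib_base2 (n m k d : ℕ) (hk : 1 ≤ k)
    (hd : d = Nat.log 2 (Nat.fib k) + 1) :
    lucas n = 2 ^ d * lucas m + Nat.fib k ↔
      (n, m, k, d) ∈ ({(2, 1, 1, 1), (2, 1, 2, 1), (4, 1, 4, 2), (4, 2, 1, 1),
        (4, 2, 2, 1), (5, 0, 4, 2), (6, 3, 3, 2), (7, 1, 7, 4), (7, 2, 5, 3),
        (8, 5, 4, 2)} : Set (ℕ × ℕ × ℕ × ℕ)) := by
  have hfpos : 0 < Nat.fib k := Nat.fib_pos.2 hk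
  have hlo : Nat.fib k < 2 ^ d := by
    rw [hd]; exact Nat.lt_pow_succ_log_self (by omega) _
  have hhi : 2 ^ d ≤ 2 * Nat.fib k := by
    rw [hd, pow_succ]
    have := Nat.pow_log_le_self 2 hfpos.ne'
    omega
  clear hd
  have l0 : lucas 0 = 2 := by decide
  have l1 : lucas 1 = 1 := by decide
  have l2 : lucas 2 = 3 := by decide
  have l3 : lucas 3 = 4 := by decide
  have l4 : lucas 4 = 7 := by decide
  have l5 : lucas 5 = 11 := by decide
  have l6 : lucas 6 = 18 := by decide
  have l7 : lucas 7 = 29 := by decide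
  have l8 : lucas 8 = 47 := by decide
  -- determination of d from the value of 2 ^ d
  have dval : ∀ e, 2 ^ d = 2 ^ e → d = e := fun e h => Nat.pow_right_injective le_rfl h
  constructor
  swap
  · intro h
    simp only [Set.mem_insert_iff, Set.mem_singleton_iff, Prod.mk.injEq] at h
    rcases h with h | h | h | h | h | h | h | h | h | h <;>
      obtain ⟨rfl, rfl, rfl, rfl⟩ := h <;> decide
  intro h
  simp only [Set.mem_insert_iff, Set.mem_singleton_iff, Prod.mk.injEq]
  have dle : ∀ e, 2 ^ d < 2 ^ (e + 1) → d ≤ e := fun e h =>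
    Nat.lt_succ_iff.1 ((Nat.pow_lt_pow_iff_right (by omega)).1 h)
  -- small k
  rcases Nat.lt_or_ge k 4 with hk4 | hk4
  · have hm : ∀ a, 2 ≤ a → lucas a < lucas n → lucas n < lucas (a + 1) → False := by
      intro a ha p q
      have := luc_lt (a := a + 1) (b := a + 2) (by omega) (by omega)
      have := luc_loc ha p (by omega)
      subst this
      omega
    have hk' : (k = 1 ∨ k = 2) ∨ k = 3 := by omega
    rcases hk' with hk' | rfl
    · have hf : Nat.fib k = 1 := by rcases hk' with rfl | rfl <;> decide
      rw [hf] at h hlo hhi hfpos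
      have hd1 : d = 1 := dval 1 (by omega)
      subst hd1
      rcases Nat.lt_or_ge m 3 with hm3 | hm3
      · interval_cases m
        · exact (hm 3 (by omega) (by omega) (by simp only [Nat.reduceAdd]; omega)).elim
        · have hn : n = 2 := by
            by_contra hn
            rcases Nat.lt_or_ge n 2 with h' | h'
            · interval_cases n <;> omega
            · have := luc_lt (a := 2) (b := n) (by omega) (by omega)
              omega
          subst hn; rcases hk' with rfl | rfl <;> simp
        · have hn : n = 3 + 1 := luc_loc (by omega) (by omega) (by simp only [Nat.reduceAdd]; omega)
          subst hn; rcases hk' with rfl | rfl <;> simp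
      · exfalso
        obtain ⟨c, rfl⟩ : ∃ c, m = c + 1 := ⟨m - 1, by omega⟩
        have e1 := luc_rec c
        have e2 := luc_rec (c + 1)
        have e3 := luc_le (a := 2) (b := c) (by omega) (by omega)
        have e4 := luc_lt (a := c) (b := c + 1) (by omega) (by omega)
        exact hm (c + 2) (by omega) (by omega) (by
          have : lucas (c + 2 + 1) = lucas (c + 1 + 2) := rfl
          have : lucas (c + 1 + 1) = lucas (c + 2) := rfl
          omega)
    · have hf : Nat.fib 3 = 2 := by decide
      rw [hf] at h hlo hhi hfpos
      have hd1 : d = 2 := by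
        have := dle 2 (by omega)
        interval_cases d <;> omega
      subst hd1
      rcases Nat.lt_or_ge m 5 with hm3 | hm3
      · interval_cases m
        · exact (hm 4 (by omega) (by omega) (by simp only [Nat.reduceAdd]; omega)).elim
        · exact (hm 3 (by omega) (by omega) (by simp only [Nat.reduceAdd]; omega)).elim
        · exact (hm 5 (by omega) (by omega) (by simp only [Nat.reduceAdd]; omega)).elim
        · have hn : n = 5 + 1 := luc_loc (by omega) (by omega) (by simp only [Nat.reduceAdd]; omega)
          subst hn; simp
        · exact (hm 7 (by omega) (by omega) (by simp only [Nat.reduceAdd]; omega)).elim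
      · exfalso
        obtain ⟨c, rfl⟩ : ∃ c, m = c + 3 := ⟨m - 3, by omega⟩
        have e0 : lucas (c + 2) = lucas (c + 1) + lucas c := luc_rec c
        have e1 : lucas (c + 3) = lucas (c + 2) + lucas (c + 1) := luc_rec (c + 1)
        have e2 : lucas (c + 4) = lucas (c + 3) + lucas (c + 2) := luc_rec (c + 2)
        have e3 : lucas (c + 5) = lucas (c + 4) + lucas (c + 3) := luc_rec (c + 3)
        have e4 : lucas (c + 6) = lucas (c + 5) + lucas (c + 4) := luc_rec (c + 4)
        have e5 := luc_le (a := 2) (b := c) (by omega) (by omega)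
        exact hm (c + 5) (by omega) (by omega) (by
          have : lucas (c + 5 + 1) = lucas (c + 6) := rfl
          omega)
  -- k ≥ 4
  obtain ⟨j, rfl⟩ : ∃ j, k = j + 4 := ⟨k - 4, by omega⟩
  have r2 : Nat.fib (j + 2) = Nat.fib j + Nat.fib (j + 1) := Nat.fib_add_two
  have r3 : Nat.fib (j + 3) = Nat.fib (j + 1) + Nat.fib (j + 2) := Nat.fib_add_two
  have r4 : Nat.fib (j + 4) = Nat.fib (j + 2) + Nat.fib (j + 3) := Nat.fib_add_two
  have r5 : Nat.fib (j + 5) = Nat.fib (j + 3) + Nat.fib (j + 4) := Nat.fib_add_two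
  have r6 : Nat.fib (j + 6) = Nat.fib (j + 4) + Nat.fib (j + 5) := Nat.fib_add_two
  have r7 : Nat.fib (j + 7) = Nat.fib (j + 5) + Nat.fib (j + 6) := Nat.fib_add_two
  have r8 : Nat.fib (j + 8) = Nat.fib (j + 6) + Nat.fib (j + 7) := Nat.fib_add_two
  have r9 : Nat.fib (j + 9) = Nat.fib (j + 7) + Nat.fib (j + 8) := Nat.fib_add_two
  have p0 : Nat.fib j ≤ Nat.fib (j + 1) := Nat.fib_le_fib_succ
  have p1 : 0 < Nat.fib (j + 1) := Nat.fib_pos.2 (by omega)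
  have q3 : lucas (j + 3) = Nat.fib (j + 2) + Nat.fib (j + 4) := luc_fib _
  have q4 : lucas (j + 4) = Nat.fib (j + 3) + Nat.fib (j + 5) := luc_fib _
  have q5 : lucas (j + 5) = Nat.fib (j + 4) + Nat.fib (j + 6) := luc_fib _
  have q6 : lucas (j + 6) = Nat.fib (j + 5) + Nat.fib (j + 7) := luc_fib _
  have q7 : lucas (j + 7) = Nat.fib (j + 6) + Nat.fib (j + 8) := luc_fib _
  have q8 : lucas (j + 8) = Nat.fib (j + 7) + Nat.fib (j + 9) := luc_fib _
  have c2 : Nat.fib 2 = 1 := by decide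
  have c3 : Nat.fib 3 = 2 := by decide
  have c4 : Nat.fib 4 = 3 := by decide
  have c5 : Nat.fib 5 = 5 := by decide
  have c6 : Nat.fib 6 = 8 := by decide
  have c7 : Nat.fib 7 = 13 := by decide
  rcases Nat.lt_or_ge m 3 with hm3 | hm3
  · interval_cases m
    · rw [l0] at h
      have hn : n = j + 4 + 1 := luc_loc (by omega) (by omega) (by
        show lucas n < lucas (j + 6)
        omega)
      subst hn
      have hp : Nat.fib (j + 6) = 2 ^ (d + 1) := by
        rw [pow_succ]
        have : lucas (j + 4 + 1) = lucas (j + 5) := rfl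
        omega
      have := fib_pow_two hp
      obtain rfl : j = 0 := by omega
      have hd1 : d = 2 := by
        simp only [Nat.zero_add] at *
        exact dval 2 (by rw [pow_succ] at hp; omega)
      subst hd1; simp
    · rw [l1] at h
      have hn : n = j + 3 + 1 := luc_loc (by omega) (by omega) (by
        show lucas n < lucas (j + 5)
        omega)
      subst hn
      have hp2 : 2 * Nat.fib (j + 3) = 2 ^ d := by
        have : lucas (j + 3 + 1) = lucas (j + 4) := rfl
        omega
      obtain ⟨e, rfl⟩ : ∃ e, d = e + 1 := by
        refine ⟨d - 1, ?_⟩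
        rcases Nat.eq_zero_or_pos d with rfl | hd
        · rw [pow_zero] at hp2; omega
        · omega
      have hp : Nat.fib (j + 3) = 2 ^ e := by
        rw [pow_succ] at hp2; omega
      have := fib_pow_two hp
      have hj : j ≤ 3 := by omega
      have he := dle 4 (by
        have := Nat.fib_mono (show j + 3 ≤ 6 by omega)
        omega)
      have he : e ≤ 3 := by omega
      interval_cases j <;> simp only [Nat.zero_add, Nat.reduceAdd] at * <;>
        interval_cases e <;> first | (exfalso; omega) | simp
    · rw [l2] at h
      have hn : n = j + 5 + 1 := luc_loc (by omega) (by omega) (by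
        show lucas n < lucas (j + 7)
        omega)
      subst hn
      have hp : Nat.fib (j + 5) = 2 ^ d := by
        have : lucas (j + 5 + 1) = lucas (j + 6) := rfl
        omega
      have := fib_pow_two hp
      have hj : j ≤ 1 := by omega
      have he := dle 3 (by
        have := Nat.fib_mono (show j + 5 ≤ 6 by omega)
        omega)
      interval_cases j <;> simp only [Nat.zero_add, Nat.reduceAdd] at * <;>
        interval_cases d <;> first | (exfalso; omega) | simp
  -- m ≥ 3
  obtain ⟨c, rfl⟩ : ∃ c, m = c + 3 := ⟨m - 3, by omega⟩
  have e2 : lucas (c + 2) = lucas (c + 1) + lucas c := luc_rec c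
  have e3 : lucas (c + 3) = lucas (c + 2) + lucas (c + 1) := luc_rec (c + 1)
  have g0 := luc_pos c
  have g1 := luc_pos (c + 1)
  have hn : n = c + 3 + (j + 2) + 1 := by
    apply luc_loc (by omega)
    · have := luc_add (c + 2) (j + 2)
      rw [show c + 2 + 1 = c + 3 by rfl, show j + 2 + 1 = j + 3 by rfl] at this
      rw [this, h]
      have t1 : Nat.fib (j + 4) * lucas (c + 3) ≤ 2 ^ d * lucas (c + 3) :=
        Nat.mul_le_mul_right _ hlo.le
      have t2 : Nat.fib (j + 2) * lucas (c + 2) ≤ Nat.fib (j + 2) * lucas (c + 3) :=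
        Nat.mul_le_mul_left _ (by omega)
      rw [r4, Nat.add_mul] at t1
      omega
    · have := luc_add (c + 2) (j + 4)
      rw [show c + 2 + 1 = c + 3 by rfl, show j + 4 + 1 = j + 5 by rfl] at this
      rw [show c + 3 + (j + 2) + 2 = c + 3 + (j + 4) by ring, this, h]
      have t1 : 2 ^ d * lucas (c + 3) ≤ 2 * Nat.fib (j + 4) * lucas (c + 3) :=
        Nat.mul_le_mul_right _ hhi
      have t2 : Nat.fib (j + 4) * (lucas (c + 1) + 1) < Nat.fib (j + 3) * lucas (c + 3) := by
        rw [e3, e2]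
        have hx : 3 * Nat.fib (j + 4) ≤ 5 * Nat.fib (j + 3) := by omega
        have hy : 5 * (lucas (c + 1) + 1) < 3 * (lucas (c + 1) + lucas c + lucas (c + 1)) := by
          rcases Nat.lt_or_ge c 3 with hc | hc
          · interval_cases c <;> simp only [Nat.zero_add, Nat.reduceAdd, l0, l1, l2, l3] <;> omega
          · have := luc_le (a := 3) (b := c) (by omega) hc
            omega
        have f3 : 0 < Nat.fib (j + 3) := by omega
        have s1 : 3 * Nat.fib (j + 4) * (lucas (c + 1) + 1) ≤
            5 * Nat.fib (j + 3) * (lucas (c + 1) + 1) := Nat.mul_le_mul_right _ hx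
        have s2 := Nat.mul_lt_mul_of_pos_left hy f3
        clear * - s1 s2
        linarith
      have t3 : Nat.fib (j + 4) * lucas (c + 3) = Nat.fib (j + 4) * lucas (c + 2) +
        Nat.fib (j + 4) * lucas (c + 1) := by rw [e3]; ring
      rw [r5, Nat.add_mul]
      rw [Nat.mul_add, Nat.mul_one] at t2
      rw [Nat.mul_assoc] at t1
      clear * - t1 t2 t3
      omega
  subst hn
  have key := h
  have hadd := luc_add (c + 2) (j + 3)
  rw [show c + 2 + 1 = c + 3 by rfl, show j + 3 + 1 = j + 4 by rfl] at hadd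
  rw [show c + 3 + (j + 2) + 1 = c + 3 + (j + 3) by ring] at key
  rcases Nat.lt_or_ge c 3 with hc | hc
  · rw [hadd] at key
    interval_cases c <;> simp only [Nat.zero_add, Nat.reduceAdd, l2, l3, l4, l5] at key
    · exfalso
      have h3 : 3 ∣ 2 ^ d := by omega
      have := Nat.Prime.dvd_of_dvd_pow Nat.prime_three h3
      omega
    · exfalso
      exact fib_seven (j := j + 7) (d := d) (by omega)
    · rcases Nat.lt_or_ge d 3 with hd | hd
      · have hj : j = 0 := by
          by_contra hj
          have := Nat.fib_mono (show 5 ≤ j + 4 by omega)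
          interval_cases d <;> omega
        subst hj
        simp only [Nat.zero_add] at *
        interval_cases d <;> first | (exfalso; omega) | simp
      · exfalso
        have h8 : 8 ∣ 2 ^ d := pow_dvd_pow 2 hd
        refine no_eight (k := j + 4) ?_
        rw [show j + 4 + 1 = j + 5 by rfl]
        omega
  · exfalso
    refine mod_lemma (M := c + 2) (by omega) (j + 4) ?_
    rw [show c + 2 + (j + 4) = c + 3 + (j + 3) by ring, key]
    push_cast
    exact ⟨2 ^ d, by rw [show c + 2 + 1 = c + 3 by rfl]; ring⟩
end
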